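/- arXiv:1806.11283 — 6 statements merged into one kernel-verified Lean document; each statement's English description precedes it below -/
import Mathlib

section
/- There is no constant C > 0 such that for every smooth compactly supported function Ψ : ℝ⁴ → ℂ⁴ one has ∫_{ℝ⁴} Ψ(x)† (cosh(x₀)·I₄ + sinh(x₀)·γ₀γ₁) Ψ(x) dx ≤ C · ∫_{ℝ⁴} ‖Ψ(x)‖² dx. In other words, the norm ‖Ψ‖_n associated to the fundamental symmetry n(x) = cosh(x₀)γ₀ + sinh(x₀)γ₁ and the norm ‖Ψ‖_η associated to η(x) = γ₀ are not equivalent on compactly supported spinor fields on Minkowski space. -/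
open MeasureTheory Matrix Complex

/-- The Dirac gamma matrix `γ₀ = diag(1,1,-1,-1)`. -/
noncomputable def γ0 : Matrix (Fin 4) (Fin 4) ℂ :=
  !![1, 0, 0, 0; 0, 1, 0, 0; 0, 0, -1, 0; 0, 0, 0, -1]

/-- The Dirac gamma matrix `γ₁`. -/
noncomputable def γ1 : Matrix (Fin 4) (Fin 4) ℂ :=
  !![0, 0, 0, 1; 0, 0, 1, 0; 0, -1, 0, 0; -1, 0, 0, 0]

/-- The matrix `n(x) = cosh(x₀)·I₄ + sinh(x₀)·γ₀γ₁` of the fundamental symmetry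
`n(x) = cosh(x₀)γ₀ + sinh(x₀)γ₁` composed with `γ₀`. -/
noncomputable def nMat (x : Fin 4 → ℝ) : Matrix (Fin 4) (Fin 4) ℂ :=
  (Real.cosh (x 0) : ℂ) • (1 : Matrix (Fin 4) (Fin 4) ℂ) +
    (Real.sinh (x 0) : ℂ) • (γ0 * γ1)

/-- For a spinor field with only its first component nonzero and real, the off-diagonal term
`γ₀γ₁` does not contribute. -/
theorem re_star_dotProduct_nMat_mulVec_single (x : Fin 4 → ℝ) (a : ℝ) :
    (star (Pi.single 0 (a : ℂ) : Fin 4 → ℂ) ⬝ᵥ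
      (nMat x).mulVec (Pi.single 0 (a : ℂ))).re = Real.cosh (x 0) * a ^ 2 := by
  simp [nMat, γ0, γ1, dotProduct, Matrix.mulVec, Fin.sum_univ_four, -Complex.ofReal_cosh,
    -Complex.ofReal_sinh]
  ring

theorem re_star_dotProduct_single (a : ℝ) :
    (star (Pi.single 0 (a : ℂ) : Fin 4 → ℂ) ⬝ᵥ Pi.single 0 (a : ℂ)).re = a ^ 2 := by
  simp [dotProduct, Fin.sum_univ_four]
  ring

/-- There is no constant `C > 0` such that for every smooth compactly supported
`Ψ : ℝ⁴ → ℂ⁴` one has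
`∫ Ψ(x)† (cosh(x₀)I₄ + sinh(x₀)γ₀γ₁) Ψ(x) dx ≤ C ∫ ‖Ψ(x)‖² dx`:
the `n`-norm and `η`-norm are not equivalent. -/
theorem statement0 :
    ¬ ∃ C : ℝ, 0 < C ∧ ∀ Ψ : (Fin 4 → ℝ) → (Fin 4 → ℂ),
      ContDiff ℝ (⊤ : ℕ∞) Ψ → HasCompactSupport Ψ →
      (∫ x : Fin 4 → ℝ, (star (Ψ x) ⬝ᵥ (nMat x).mulVec (Ψ x)).re) ≤
        C * ∫ x : Fin 4 → ℝ, (star (Ψ x) ⬝ᵥ Ψ x).re := by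
  rintro ⟨C, hC, h⟩
  let c : Fin 4 → ℝ := Pi.single 0 (C + 3)
  let f : ContDiffBump c := ⟨1, 2, one_pos, one_lt_two⟩
  have hf0 : f c ≠ 0 := by
    rw [f.one_of_mem_closedBall (Metric.mem_closedBall_self zero_le_one)]
    exact one_ne_zero
  have hfsq : HasCompactSupport fun x => f x ^ 2 :=
    f.hasCompactSupport.comp_left (g := fun t : ℝ => t ^ 2) (by simp)
  have hcosh : Continuous fun x : Fin 4 → ℝ => Real.cosh (x 0) :=
    Real.continuous_cosh.comp (continuous_apply 0)
  have hcont : Continuous fun x => f x ^ 2 := f.continuous.pow 2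
  have hle : ∀ x, (C + 1) * f x ^ 2 ≤ Real.cosh (x 0) * f x ^ 2 := by
    intro x
    by_cases hx : f x = 0
    · simp [hx]
    have hball : x ∈ Metric.ball c 2 := f.support_eq ▸ Function.mem_support.2 hx
    have hdist : |x 0 - (C + 3)| < 2 := by
      simpa [c, Real.dist_eq] using (dist_le_pi_dist x c 0).trans_lt hball
    have hx0 : C + 1 < x 0 := by linarith [(abs_lt.1 hdist).1]
    have hsinh : x 0 ≤ Real.sinh (x 0) := Real.self_le_sinh_iff.2 (by linarith)
    gcongr
    linarith [Real.sinh_lt_cosh (x 0)]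
  have hpos : 0 < ∫ x, f x ^ 2 :=
    hcont.integral_pos_of_hasCompactSupport_nonneg_nonzero hfsq (fun x => sq_nonneg _)
      (pow_ne_zero 2 hf0)
  have hmono : (C + 1) * ∫ x, f x ^ 2 ≤ ∫ x, Real.cosh (x 0) * f x ^ 2 := by
    rw [← integral_const_mul]
    exact integral_mono ((hcont.integrable_of_hasCompactSupport hfsq).const_mul _)
      ((hcosh.mul hcont).integrable_of_hasCompactSupport hfsq.mul_left) hle
  have hbound := h (fun x => Pi.single 0 (f x : ℂ))
    (by
      rw [contDiff_pi]
      intro i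
      by_cases hi : i = 0
      · subst hi
        simpa [Function.comp_def] using Complex.ofRealCLM.contDiff.comp f.contDiff
      · simpa [hi] using contDiff_const)
    (f.hasCompactSupport.comp_left (g := fun t : ℝ => (Pi.single 0 (t : ℂ) : Fin 4 → ℂ))
      (by simp))
  simp only [re_star_dotProduct_nMat_mulVec_single, re_star_dotProduct_single] at hbound
  linarith
end

section
/- There exists a sequence (Ψ_k) of smooth compactly supported functions ℝ⁴ → ℂ⁴ which is a Cauchy sequence for the norm ‖Ψ‖_η := (∫_{ℝ⁴} ‖Ψ(x)‖² dx)^{1/2} but is not a Cauchy sequence for the norm ‖Ψ‖_n := (∫_{ℝ⁴} Ψ(x)†(cosh(x₀)I₄ + sinh(x₀)γ₀γ₁)Ψ(x) dx)^{1/2}. Consequently the completions of the space of compactly supported spinor fields with respect to the two norms differ. -/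
open MeasureTheory Matrix Complex

/-- The norm `‖Ψ‖_η = (∫ ‖Ψ(x)‖² dx)^{1/2}` associated to the fundamental symmetry `η = γ₀`. -/
noncomputable def etaNorm (Ψ : (Fin 4 → ℝ) → (Fin 4 → ℂ)) : ℝ :=
  Real.sqrt (∫ x : Fin 4 → ℝ, (star (Ψ x) ⬝ᵥ Ψ x).re)

/-- The norm `‖Ψ‖_n = (∫ Ψ(x)†(cosh(x₀)I₄ + sinh(x₀)γ₀γ₁)Ψ(x) dx)^{1/2}` associated to the
fundamental symmetry `n(x) = cosh(x₀)γ₀ + sinh(x₀)γ₁`. -/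
noncomputable def nNorm (Ψ : (Fin 4 → ℝ) → (Fin 4 → ℂ)) : ℝ :=
  Real.sqrt (∫ x : Fin 4 → ℝ, (star (Ψ x) ⬝ᵥ (nMat x).mulVec (Ψ x)).re)

/-- The spinor field `x ↦ (f x, 0, 0, 0)` attached to a real scalar field `f`. -/
noncomputable def scalarSpinor (f : (Fin 4 → ℝ) → ℝ) : (Fin 4 → ℝ) → (Fin 4 → ℂ) :=
  fun x => Pi.single 0 (f x : ℂ)

theorem scalarSpinor_sub (f g : (Fin 4 → ℝ) → ℝ) :
    scalarSpinor f - scalarSpinor g = scalarSpinor (fun x => f x - g x) := by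
  funext x
  simp [scalarSpinor, Pi.single_sub]

theorem etaNorm_scalarSpinor (f : (Fin 4 → ℝ) → ℝ) :
    etaNorm (scalarSpinor f) = Real.sqrt (∫ x, f x ^ 2) := by
  unfold etaNorm scalarSpinor
  congr 2
  funext x
  simp [sq]

theorem nNorm_scalarSpinor (f : (Fin 4 → ℝ) → ℝ) :
    nNorm (scalarSpinor f) = Real.sqrt (∫ x, Real.cosh (x 0) * f x ^ 2) := by
  unfold nNorm scalarSpinor
  congr 2
  funext x
  have h : nMat x 0 0 = (Real.cosh (x 0) : ℂ) := by
    simp [nMat, γ0, γ1]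
  rw [← Pi.single_star, single_dotProduct, mulVec_single]
  simp only [Pi.smul_apply, Matrix.col_apply, h, MulOpposite.smul_eq_mul_unop,
    MulOpposite.unop_op, RCLike.star_def, conj_ofReal, ← ofReal_mul, ofReal_re]
  ring

theorem contDiff_scalarSpinor {f : (Fin 4 → ℝ) → ℝ} (hf : ContDiff ℝ (⊤ : ℕ∞) f) :
    ContDiff ℝ (⊤ : ℕ∞) (scalarSpinor f) := by
  refine contDiff_pi.2 fun i => ?_
  by_cases hi : i = 0
  · subst hi
    simpa [scalarSpinor, Function.comp_def] using ofRealCLM.contDiff.comp hf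
  · simpa [scalarSpinor, Pi.single_eq_of_ne hi] using contDiff_const

theorem hasCompactSupport_scalarSpinor {f : (Fin 4 → ℝ) → ℝ} (hf : HasCompactSupport f) :
    HasCompactSupport (scalarSpinor f) :=
  hf.comp_left (g := fun t : ℝ => (Pi.single 0 (t : ℂ) : Fin 4 → ℂ)) (by simp)

/-- The translate of `φ` by `k` in the time direction, damped by the factor `exp (-k / 4)`. -/
noncomputable def dampedTranslate (φ : (Fin 4 → ℝ) → ℝ) (k : ℕ) : (Fin 4 → ℝ) → ℝ :=
  fun x => Real.exp (-(k / 4)) * φ (x - Pi.single 0 (k : ℝ))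

section dampedTranslate

variable {φ : (Fin 4 → ℝ) → ℝ}

theorem contDiff_dampedTranslate (hφ : ContDiff ℝ (⊤ : ℕ∞) φ) (k : ℕ) :
    ContDiff ℝ (⊤ : ℕ∞) (dampedTranslate φ k) :=
  contDiff_const.mul (hφ.comp (contDiff_id.sub contDiff_const))

theorem hasCompactSupport_dampedTranslate (hc : HasCompactSupport φ) (k : ℕ) :
    HasCompactSupport (dampedTranslate φ k) :=
  (hc.comp_homeomorph (Homeomorph.subRight (Pi.single 0 (k : ℝ)))).mul_left

theorem integral_dampedTranslate_sq (k : ℕ) :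
    ∫ x, dampedTranslate φ k x ^ 2 = Real.exp (-(k / 2)) * ∫ x, φ x ^ 2 := by
  rw [← integral_sub_right_eq_self (fun x => φ x ^ 2) (Pi.single 0 (k : ℝ)),
    ← integral_const_mul]
  congr 1
  funext x
  rw [dampedTranslate, mul_pow, ← Real.exp_nat_mul]
  congr 2
  push_cast
  ring

theorem integral_exp_mul_dampedTranslate_sq (k : ℕ) :
    ∫ x, Real.exp (x 0) * dampedTranslate φ k x ^ 2 =
      Real.exp (k / 2) * ∫ x, Real.exp (x 0) * φ x ^ 2 := by
  rw [← integral_sub_right_eq_self (fun x => Real.exp (x 0) * φ x ^ 2) (Pi.single 0 (k : ℝ)),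
    ← integral_const_mul]
  congr 1
  funext x
  rw [dampedTranslate, mul_pow, ← Real.exp_nat_mul, ← mul_assoc, ← mul_assoc, ← Real.exp_add,
    ← Real.exp_add]
  congr 2
  simp only [Pi.sub_apply, Pi.single_eq_same]
  push_cast
  ring

end dampedTranslate

theorem integrable_mul_sq {w f : (Fin 4 → ℝ) → ℝ} (hw : Continuous w) (hf : Continuous f)
    (hc : HasCompactSupport f) : Integrable (fun x => w x * f x ^ 2) := by
  have hsq : HasCompactSupport (fun x => f x ^ 2) :=
    hc.comp_left (g := fun t : ℝ => t ^ 2) (by simp)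
  exact Continuous.integrable_of_hasCompactSupport (by fun_prop) hsq.mul_left

theorem integral_sub_sq_le {f g : (Fin 4 → ℝ) → ℝ} (hf : Continuous f)
    (hfc : HasCompactSupport f) (hg : Continuous g) (hgc : HasCompactSupport g) :
    ∫ x, (f x - g x) ^ 2 ≤ 2 * (∫ x, f x ^ 2) + 2 * ∫ x, g x ^ 2 := by
  have hF := integrable_mul_sq (w := fun _ => 2) continuous_const hf hfc
  have hG := integrable_mul_sq (w := fun _ => 2) continuous_const hg hgc
  have hD : Integrable (fun x => (f x - g x) ^ 2) := by
    simpa using integrable_mul_sq (w := fun _ => 1) continuous_const (hf.sub hg) (hfc.sub hgc)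
  rw [← integral_const_mul, ← integral_const_mul, ← integral_add hF hG]
  refine integral_mono hD (hF.add hG) fun x => ?_
  simp only
  nlinarith [sq_nonneg (f x + g x)]

theorem le_integral_cosh_mul_sub_sq {f g : (Fin 4 → ℝ) → ℝ} (hf : Continuous f)
    (hfc : HasCompactSupport f) (hg : Continuous g) (hgc : HasCompactSupport g) :
    1 / 4 * (∫ x, Real.exp (x 0) * g x ^ 2) - (∫ x, Real.cosh (x 0) * f x ^ 2) ≤
      ∫ x, Real.cosh (x 0) * (f x - g x) ^ 2 := by
  have hcosh : Continuous fun x : Fin 4 → ℝ => Real.cosh (x 0) := by fun_prop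
  have hexp : Continuous fun x : Fin 4 → ℝ => Real.exp (x 0) := by fun_prop
  have hF := integrable_mul_sq hcosh hf hfc
  have hG := (integrable_mul_sq hexp hg hgc).const_mul (1 / 4)
  have hD := integrable_mul_sq hcosh (hf.sub hg) (hfc.sub hgc)
  rw [← integral_const_mul, ← integral_sub hG hF]
  refine integral_mono (hG.sub hF) hD fun x => ?_
  have h1 : Real.exp (x 0) ≤ 2 * Real.cosh (x 0) := by
    rw [Real.cosh_eq]
    linarith [Real.exp_pos (-x 0)]
  have h2 : 0 ≤ Real.cosh (x 0) * (2 * f x - g x) ^ 2 :=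
    mul_nonneg (Real.cosh_pos _).le (sq_nonneg _)
  have h3 := mul_le_mul_of_nonneg_right h1 (sq_nonneg (g x))
  simp only
  linarith

/-- There is a sequence of smooth compactly supported spinor fields on Minkowski space which is
Cauchy for the `η`-norm but not for the `n`-norm; hence the two completions differ. -/
theorem statement1 :
    ∃ Ψ : ℕ → (Fin 4 → ℝ) → (Fin 4 → ℂ),
      (∀ k, ContDiff ℝ (⊤ : ℕ∞) (Ψ k) ∧ HasCompactSupport (Ψ k)) ∧
      (∀ ε : ℝ, 0 < ε → ∃ N : ℕ, ∀ m ≥ N, ∀ n ≥ N, etaNorm (Ψ m - Ψ n) < ε) ∧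
      ¬ (∀ ε : ℝ, 0 < ε → ∃ N : ℕ, ∀ m ≥ N, ∀ n ≥ N, nNorm (Ψ m - Ψ n) < ε) := by
  let φ : ContDiffBump (0 : Fin 4 → ℝ) := ⟨1, 2, one_pos, one_lt_two⟩
  have hφ : ContDiff ℝ (⊤ : ℕ∞) φ := φ.contDiff
  have hs := contDiff_dampedTranslate hφ
  have hcs := hasCompactSupport_dampedTranslate φ.hasCompactSupport
  have hcont := fun k => (hs k).continuous
  refine ⟨fun k => scalarSpinor (dampedTranslate φ k),
    fun k => ⟨contDiff_scalarSpinor (hs k), hasCompactSupport_scalarSpinor (hcs k)⟩, ?_, ?_⟩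
  · intro ε hε
    have hhalf : Filter.Tendsto (fun k : ℕ => (k : ℝ) / 2) Filter.atTop Filter.atTop :=
      tendsto_natCast_atTop_atTop.atTop_div_const two_pos
    have hlim : Filter.Tendsto (fun k : ℕ => Real.exp (-((k : ℝ) / 2)) * ∫ x, φ x ^ 2)
        Filter.atTop (nhds 0) := by
      simpa using (Real.tendsto_exp_neg_atTop_nhds_zero.comp hhalf).mul_const (∫ x, φ x ^ 2)
    obtain ⟨N, hN⟩ := Filter.eventually_atTop.1
      (hlim.eventually_lt_const (show (0 : ℝ) < ε ^ 2 / 4 by positivity))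
    refine ⟨N, fun m hm n hn => ?_⟩
    rw [scalarSpinor_sub, etaNorm_scalarSpinor, Real.sqrt_lt' hε]
    have h := integral_sub_sq_le (hcont m) (hcs m) (hcont n) (hcs n)
    rw [integral_dampedTranslate_sq, integral_dampedTranslate_sq] at h
    linarith [hN m hm, hN n hn]
  · intro h
    obtain ⟨N, hN⟩ := h 1 one_pos
    have hB : 0 < ∫ x : Fin 4 → ℝ, Real.exp (x 0) * φ x ^ 2 := by
      refine Continuous.integral_pos_of_hasCompactSupport_nonneg_nonzero (x := 0) ?_ ?_ ?_ ?_
      · exact (Real.continuous_exp.comp (continuous_apply 0)).mul (hφ.continuous.pow 2)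
      · exact (φ.hasCompactSupport.comp_left (g := fun t : ℝ => t ^ 2) (by simp)).mul_left
      · exact fun x => by positivity
      · have h0 : φ 0 = 1 := φ.one_of_mem_closedBall (by simp [φ])
        simp [h0]
    have hlim : Filter.Tendsto
        (fun k : ℕ => Real.exp ((k : ℝ) / 2) * ∫ x : Fin 4 → ℝ, Real.exp (x 0) * φ x ^ 2)
        Filter.atTop Filter.atTop :=
      (Real.tendsto_exp_atTop.comp
        (tendsto_natCast_atTop_atTop.atTop_div_const two_pos)).atTop_mul_const hB
    obtain ⟨n, hn, hNn⟩ := ((hlim.eventually_ge_atTop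
      (4 * (1 + ∫ x, Real.cosh (x 0) * dampedTranslate φ N x ^ 2))).and
      (Filter.eventually_ge_atTop N)).exists
    have hlt := hN N le_rfl n hNn
    rw [scalarSpinor_sub, nNorm_scalarSpinor, Real.sqrt_lt' one_pos] at hlt
    have hle := le_integral_cosh_mul_sub_sq (hcont N) (hcs N) (hcont n) (hcs n)
    rw [integral_exp_mul_dampedTranslate_sq] at hle
    linarith
end

section
/- Let v₁, v₂ : ℝ⁴ → ℝ⁴ be continuous maps such that for every x, η(v_i(x), v_i(x)) = 1 and v_i(x)₀ > 0. Define D(x) := η(v₁(x),v₂(x)) + √(η(v₁(x),v₂(x))² − 1), and suppose sup_{x∈ℝ⁴} D(x) = ∞ (the Doppler shift factor is unbounded). Then the spinor norms ‖Ψ‖_{n₁}² := ∫ Ψ(x)†γ₀·(v₁(x)·γ)Ψ(x) dx and ‖Ψ‖_{n₂}² := ∫ Ψ(x)†γ₀·(v₂(x)·γ)Ψ(x) dx are not equivalent: for every C > 0 there exists a smooth compactly supported Ψ : ℝ⁴ → ℂ⁴ with ‖Ψ‖_{n₁} > C·‖Ψ‖_{n₂}. -/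
open Matrix Complex ComplexOrder

/-- The Dirac gamma matrix `γ₂`. -/
noncomputable def γ2 : Matrix (Fin 4) (Fin 4) ℂ :=
  !![0, 0, 0, -I; 0, 0, I, 0; 0, I, 0, 0; -I, 0, 0, 0]

/-- The Dirac gamma matrix `γ₃`. -/
noncomputable def γ3 : Matrix (Fin 4) (Fin 4) ℂ :=
  !![0, 0, 1, 0; 0, 0, 0, -1; -1, 0, 0, 0; 0, 1, 0, 0]

/-- `v·γ := v₀γ₀ + v₁γ₁ + v₂γ₂ + v₃γ₃`. -/
noncomputable def vγ (v : Fin 4 → ℝ) : Matrix (Fin 4) (Fin 4) ℂ :=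
  (v 0 : ℂ) • γ0 + (v 1 : ℂ) • γ1 + (v 2 : ℂ) • γ2 + (v 3 : ℂ) • γ3

/-- The Minkowski form `η(u,v) = u₀v₀ − u₁v₁ − u₂v₂ − u₃v₃` on `ℝ⁴`. -/
def mink (u v : Fin 4 → ℝ) : ℝ := u 0 * v 0 - u 1 * v 1 - u 2 * v 2 - u 3 * v 3


/-- The Doppler shift factor between two future-directed unit timelike vectors. -/
noncomputable def DSF (u w : Fin 4 → ℝ) : ℝ :=
  mink u w + Real.sqrt ((mink u w) ^ 2 - 1)

/-- The constant spinor on which the form `ψ† γ₀ (w·γ) ψ` is minimal relative to `|ψ|²`, provided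
`r` is the Euclidean length of the spatial part of `w`. -/
noncomputable def extremalSpinor (r : ℝ) (w : Fin 4 → ℝ) : Fin 4 → ℂ :=
  ![(r : ℂ), 0, -(w 3 : ℂ), -((w 1 : ℂ) + (w 2 : ℂ) * I)]

/-- The value of the form `ψ† γ₀ (v·γ) ψ` on `extremalSpinor r w`. -/
def extremalDensity (r : ℝ) (w v : Fin 4 → ℝ) : ℝ :=
  v 0 * (r ^ 2 + (w 1 ^ 2 + w 2 ^ 2 + w 3 ^ 2)) - 2 * r * (v 1 * w 1 + v 2 * w 2 + v 3 * w 3)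

theorem re_form_smul_extremalSpinor (t r : ℝ) (w v : Fin 4 → ℝ) :
    (star (t • extremalSpinor r w) ⬝ᵥ
      (γ0 * vγ v).mulVec (t • extremalSpinor r w)).re = t ^ 2 * extremalDensity r w v := by
  simp [extremalSpinor, extremalDensity, vγ, γ0, γ1, γ2, γ3, dotProduct, Matrix.mulVec,
    Matrix.mul_apply, Fin.sum_univ_four]
  ring

theorem extremalDensity_nonneg {r : ℝ} {w v : Fin 4 → ℝ} (hr : 0 ≤ r)
    (hrw : r ^ 2 = w 1 ^ 2 + w 2 ^ 2 + w 3 ^ 2) (hv : 0 ≤ mink v v) (hv0 : 0 ≤ v 0) :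
    0 ≤ extremalDensity r w v := by
  have hcs : v 1 * w 1 + v 2 * w 2 + v 3 * w 3 ≤ v 0 * r := by
    apply le_of_sq_le_sq _ (mul_nonneg hv0 hr)
    have h : v 1 ^ 2 + v 2 ^ 2 + v 3 ^ 2 ≤ v 0 ^ 2 := by
      unfold mink at hv
      linarith
    calc (v 1 * w 1 + v 2 * w 2 + v 3 * w 3) ^ 2
        ≤ (v 1 ^ 2 + v 2 ^ 2 + v 3 ^ 2) * (w 1 ^ 2 + w 2 ^ 2 + w 3 ^ 2) := by
          nlinarith [sq_nonneg (v 1 * w 2 - v 2 * w 1), sq_nonneg (v 1 * w 3 - v 3 * w 1),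
            sq_nonneg (v 2 * w 3 - v 3 * w 2)]
      _ ≤ v 0 ^ 2 * r ^ 2 := by
          rw [← hrw]
          exact mul_le_mul_of_nonneg_right h (sq_nonneg r)
      _ = (v 0 * r) ^ 2 := by ring
  unfold extremalDensity
  rw [← hrw]
  nlinarith [mul_nonneg hr (sub_nonneg.2 hcs)]

theorem extremalDensity_self_neg {r : ℝ} {w : Fin 4 → ℝ} (hr : 0 ≤ r)
    (hrw : r ^ 2 = w 1 ^ 2 + w 2 ^ 2 + w 3 ^ 2) (hw : mink w w < 0) :
    extremalDensity r w w < 0 := by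
  have h : w 0 ^ 2 < r ^ 2 := by
    unfold mink at hw
    linarith
  have hlt : w 0 < r := lt_of_pow_lt_pow_left₀ 2 hr h
  have hr2 : 0 < r ^ 2 := (sq_nonneg (w 0)).trans_lt h
  have heq : extremalDensity r w w = 2 * (r ^ 2 * (w 0 - r)) := by
    unfold extremalDensity
    linear_combination (-w 0 + 2 * r) * hrw
  rw [heq]
  linarith [mul_neg_of_pos_of_neg hr2 (sub_neg.2 hlt)]

theorem extremalDensity_smul_sub (r K : ℝ) (w u v : Fin 4 → ℝ) :
    extremalDensity r w (K • v - u) = K * extremalDensity r w v - extremalDensity r w u := by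
  simp only [extremalDensity, Pi.sub_apply, Pi.smul_apply, smul_eq_mul]
  ring

theorem continuous_extremalDensity (r : ℝ) (w : Fin 4 → ℝ) :
    Continuous (extremalDensity r w) := by
  unfold extremalDensity
  fun_prop

theorem mink_smul_sub_self (K : ℝ) (u v : Fin 4 → ℝ) :
    mink (K • v - u) (K • v - u) = K ^ 2 * mink v v + mink u u - 2 * K * mink u v := by
  simp only [mink, Pi.sub_apply, Pi.smul_apply, smul_eq_mul]
  ring

theorem DSF_le_mink_add_abs (u v : Fin 4 → ℝ) : DSF u v ≤ mink u v + |mink u v| := by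
  unfold DSF
  gcongr
  exact Real.sqrt_le_iff.2 ⟨abs_nonneg _, by rw [sq_abs]; linarith⟩

theorem lt_two_mul_mink_of_lt_DSF {u v : Fin 4 → ℝ} {M : ℝ} (hM : 0 ≤ M) (h : M < DSF u v) :
    M < 2 * mink u v := by
  have := h.trans_le (DSF_le_mink_add_abs u v)
  rcases abs_cases (mink u v) with ⟨h', _⟩ | ⟨h', _⟩ <;> rw [h'] at this <;> linarith

open MeasureTheory in
/-- If the relative Doppler shift between two future-directed unit timelike vector fields is
unbounded on Minkowski space, then the associated spinor norms are not equivalent: for every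
`C > 0` there is a smooth compactly supported spinor field `Ψ` with `‖Ψ‖_{n₁} > C·‖Ψ‖_{n₂}`. -/
theorem statement7 (v₁ v₂ : (Fin 4 → ℝ) → (Fin 4 → ℝ))
    (hc₁ : Continuous v₁) (hc₂ : Continuous v₂)
    (h₁ : ∀ x, mink (v₁ x) (v₁ x) = 1 ∧ 0 < v₁ x 0)
    (h₂ : ∀ x, mink (v₂ x) (v₂ x) = 1 ∧ 0 < v₂ x 0)
    (hunbdd : ¬ BddAbove (Set.range fun x => DSF (v₁ x) (v₂ x))) :
    ∀ C : ℝ, 0 < C → ∃ Ψ : (Fin 4 → ℝ) → (Fin 4 → ℂ),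
      ContDiff ℝ (⊤ : ℕ∞) Ψ ∧ HasCompactSupport Ψ ∧
      C * Real.sqrt (∫ x : Fin 4 → ℝ, (star (Ψ x) ⬝ᵥ (γ0 * vγ (v₂ x)).mulVec (Ψ x)).re) <
        Real.sqrt (∫ x : Fin 4 → ℝ, (star (Ψ x) ⬝ᵥ (γ0 * vγ (v₁ x)).mulVec (Ψ x)).re) := by
  intro C hC
  obtain ⟨_, ⟨x₀, rfl⟩, hx₀⟩ := not_bddAbove_iff.1 hunbdd ((C ^ 4 + 1) / C ^ 2)
  have hmink := lt_two_mul_mink_of_lt_DSF (by positivity) hx₀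
  rw [div_lt_iff₀ (by positivity)] at hmink
  set w := C ^ 2 • v₂ x₀ - v₁ x₀ with hw_def
  have hw : mink w w < 0 := by
    rw [mink_smul_sub_self, (h₁ x₀).1, (h₂ x₀).1]
    linarith
  set r := √(w 1 ^ 2 + w 2 ^ 2 + w 3 ^ 2)
  have hr : 0 ≤ r := Real.sqrt_nonneg _
  have hrw : r ^ 2 = w 1 ^ 2 + w 2 ^ 2 + w 3 ^ 2 := Real.sq_sqrt (by positivity)
  have hcont₁ : Continuous fun x => extremalDensity r w (v₁ x) :=
    (continuous_extremalDensity r w).comp hc₁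
  have hcont₂ : Continuous fun x => extremalDensity r w (v₂ x) :=
    (continuous_extremalDensity r w).comp hc₂
  have hpos₀ : 0 < extremalDensity r w (v₁ x₀) - C ^ 2 * extremalDensity r w (v₂ x₀) := by
    have := extremalDensity_self_neg hr hrw hw
    nth_rw 2 [hw_def] at this
    rw [extremalDensity_smul_sub] at this
    linarith
  have hcont : Continuous fun x =>
      extremalDensity r w (v₁ x) - C ^ 2 * extremalDensity r w (v₂ x) := by fun_prop
  obtain ⟨ε, hε, hball⟩ := Metric.isOpen_iff.1 (isOpen_lt continuous_const hcont) x₀ hpos₀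
  let f : ContDiffBump x₀ := ⟨ε / 2, ε, by positivity, by linarith⟩
  have hsupp : HasCompactSupport fun x => f x ^ 2 :=
    f.hasCompactSupport.comp_left (g := fun y : ℝ => y ^ 2) (by norm_num)
  have hint : ∀ g : (Fin 4 → ℝ) → ℝ, Continuous g → Integrable fun x => f x ^ 2 * g x := by
    intro g hg
    refine ((f.continuous.pow 2).mul hg).integrable_of_hasCompactSupport ?_
    exact hsupp.mul_right
  refine ⟨fun x => f x • extremalSpinor r w, f.contDiff.smul contDiff_const,
    f.hasCompactSupport.smul_right, ?_⟩
  simp only [re_form_smul_extremalSpinor]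
  have hnonneg : 0 ≤ ∫ x, f x ^ 2 * extremalDensity r w (v₂ x) :=
    integral_nonneg fun x => mul_nonneg (sq_nonneg _)
      (extremalDensity_nonneg hr hrw ((h₂ x).1 ▸ zero_le_one) (h₂ x).2.le)
  have hlt : 0 < ∫ x, f x ^ 2 *
      (extremalDensity r w (v₁ x) - C ^ 2 * extremalDensity r w (v₂ x)) := by
    refine ((f.continuous.pow 2).mul hcont).integral_pos_of_hasCompactSupport_nonneg_nonzero
      (x := x₀) ?_ ?_ ?_
    · exact hsupp.mul_right
    · intro x
      by_cases hx : x ∈ Metric.ball x₀ ε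
      · exact mul_nonneg (sq_nonneg _) (hball hx).le
      · have : f x = 0 := f.zero_of_le_dist (not_lt.1 hx)
        simp [this]
    · have : f x₀ = 1 := f.one_of_mem_closedBall (Metric.mem_closedBall_self (by positivity))
      simpa [this] using hpos₀.ne'
  have hsplit : ∫ x, f x ^ 2 *
      (extremalDensity r w (v₁ x) - C ^ 2 * extremalDensity r w (v₂ x)) =
      (∫ x, f x ^ 2 * extremalDensity r w (v₁ x)) -
        C ^ 2 * ∫ x, f x ^ 2 * extremalDensity r w (v₂ x) := by
    rw [← integral_const_mul, ← integral_sub (hint _ hcont₁) ((hint _ hcont₂).const_mul _)]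
    congr 1 with x
    ring
  rw [hsplit, sub_pos] at hlt
  calc C * √(∫ x, f x ^ 2 * extremalDensity r w (v₂ x))
      = √(C ^ 2 * ∫ x, f x ^ 2 * extremalDensity r w (v₂ x)) := by
        rw [Real.sqrt_mul (sq_nonneg C), Real.sqrt_sq hC.le]
    _ < _ := Real.sqrt_lt_sqrt (mul_nonneg (sq_nonneg C) hnonneg) hlt
end

section
/- Let V₁ and V₂ be split maximal negative definite subspaces of (V,B), and let Λ, Λ' ∈ SO(B) be such that Λ(V₁) = Λ'(V₁) = V₂. Then the operator norms with respect to the inner product g_{V₂} agree: ‖Λ'‖_{g_{V₂}} = ‖Λ‖_{g_{V₂}}. -/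
variable {V : Type*} [AddCommGroup V] [Module ℝ V]

/-- `f ∈ O(B)`: a bijective linear map preserving the bilinear form `B`. -/
def MemO (B : V →ₗ[ℝ] V →ₗ[ℝ] ℝ) (f : V →ₗ[ℝ] V) : Prop :=
  Function.Bijective f ∧ ∀ u v : V, B (f u) (f v) = B u v

/-- `f ∈ SO(B)`: an element of `O(B)` of determinant one. -/
def MemSO (B : V →ₗ[ℝ] V →ₗ[ℝ] ℝ) (f : V →ₗ[ℝ] V) : Prop :=
  MemO B f ∧ LinearMap.det f = 1

/-- `W` is a split maximal negative definite subspace of `(V,B)`: `V = W ⊕ Wᗮ`,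
`B` is negative definite on `W` and positive definite on `Wᗮ`. -/
def SplitMaxNeg (B : V →ₗ[ℝ] V →ₗ[ℝ] ℝ) (W : Submodule ℝ V) : Prop :=
  IsCompl W (LinearMap.BilinForm.orthogonal B W) ∧
    (∀ w ∈ W, w ≠ 0 → B w w < 0) ∧
    (∀ u ∈ LinearMap.BilinForm.orthogonal B W, u ≠ 0 → 0 < B u u)

/-- `s` is the involution `s_W` associated to the splitting `V = W ⊕ Wᗮ`:
`s = −id` on `W` and `s = id` on `Wᗮ`. -/
def IsFundSym (B : V →ₗ[ℝ] V →ₗ[ℝ] ℝ) (W : Submodule ℝ V) (s : V →ₗ[ℝ] V) : Prop :=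
  (∀ w ∈ W, s w = -w) ∧ (∀ u ∈ LinearMap.BilinForm.orthogonal B W, s u = u)

/-- The inner product `g_W(u,v) := B(s_W u, v)` associated to the involution `s = s_W`. -/
def gIP (B : V →ₗ[ℝ] V →ₗ[ℝ] ℝ) (s : V →ₗ[ℝ] V) : V →ₗ[ℝ] V →ₗ[ℝ] ℝ :=
  B ∘ₗ s

/-- The operator norm of an endomorphism `f` of `V` with respect to the norm induced by a
positive definite bilinear form `g`. -/
noncomputable def opNorm (g : V →ₗ[ℝ] V →ₗ[ℝ] ℝ) (f : V →ₗ[ℝ] V) : ℝ :=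
  sInf {c : ℝ | 0 ≤ c ∧ ∀ v : V, Real.sqrt (g (f v) (f v)) ≤ c * Real.sqrt (g v v)}

/-- If `f ∈ O(B)` maps `W₁` onto `W₂`, then `g_{W₂}(f v, f v)` depends only on the components of
`v = a + b` in `W₁ ⊕ W₁ᗮ`, and not on `f`. -/
theorem gIP_map_add_self {B : V →ₗ[ℝ] V →ₗ[ℝ] ℝ} {W₁ W₂ : Submodule ℝ V}
    {s f : V →ₗ[ℝ] V} (hs : IsFundSym B W₂ s) (hf : MemO B f) (hm : Submodule.map f W₁ = W₂)
    {a b : V} (ha : a ∈ W₁) (hb : b ∈ LinearMap.BilinForm.orthogonal B W₁) :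
    gIP B s (f (a + b)) (f (a + b)) = B (b - a) (a + b) := by
  have hfa : f a ∈ W₂ := hm ▸ Submodule.mem_map_of_mem ha
  have hfb : f b ∈ LinearMap.BilinForm.orthogonal B W₂ := by
    rw [LinearMap.BilinForm.mem_orthogonal_iff, ← hm]
    rintro _ ⟨w, hw, rfl⟩
    exact (hf.2 w b).trans (LinearMap.BilinForm.mem_orthogonal_iff.1 hb w hw)
  have hsf : s (f (a + b)) = f (b - a) := by
    rw [map_add, map_add, hs.1 _ hfa, hs.2 _ hfb, map_sub]
    abel
  rw [gIP, LinearMap.comp_apply, hsf, hf.2]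

/-- If `Λ, Λ' ∈ SO(B)` both map the split maximal negative definite subspace `V₁` onto `V₂`,
then they have the same operator norm with respect to the inner product `g_{V₂}`. -/
theorem statement8 [FiniteDimensional ℝ V]
    (B : V →ₗ[ℝ] V →ₗ[ℝ] ℝ) (hBsymm : ∀ u v : V, B u v = B v u)
    (hBnd : ∀ u : V, (∀ v : V, B u v = 0) → u = 0)
    (V₁ V₂ : Submodule ℝ V) (h₁ : SplitMaxNeg B V₁) (h₂ : SplitMaxNeg B V₂)
    (s₂ : V →ₗ[ℝ] V) (hs₂ : IsFundSym B V₂ s₂)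
    (Λ Λ' : V →ₗ[ℝ] V) (hΛ : MemSO B Λ) (hΛ' : MemSO B Λ')
    (hm : Submodule.map Λ V₁ = V₂) (hm' : Submodule.map Λ' V₁ = V₂) :
    opNorm (gIP B s₂) Λ' = opNorm (gIP B s₂) Λ := by
  have key : ∀ v : V, gIP B s₂ (Λ' v) (Λ' v) = gIP B s₂ (Λ v) (Λ v) := by
    intro v
    obtain ⟨a, ha, b, hb, rfl⟩ :=
      Submodule.mem_sup.1 (h₁.1.sup_eq_top ▸ Submodule.mem_top (x := v))
    rw [gIP_map_add_self hs₂ hΛ'.1 hm' ha hb, gIP_map_add_self hs₂ hΛ.1 hm ha hb]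
  simp only [opNorm, key]
end

section
/- Let V₁ and V₂ be split maximal negative definite subspaces of (V,B), let Λ ∈ SO(B) satisfy Λ(V₁) = V₂, and let Λ = O∘L be the polar decomposition of Λ with respect to the inner product g_{V₂} (so L is g_{V₂}-self-adjoint positive definite, L² = Λ*Λ, and O is a g_{V₂}-isometry). Then L and O both belong to SO(B), O(V₂) = V₂, L(V₁) = V₂, and the operator norm ‖Λ‖_{g_{V₂}} equals the spectral radius of L, i.e. its largest eigenvalue (this common value is the Doppler shift factor D.S.F(V₁,V₂)). -/
variable {V : Type*} [AddCommGroup V] [Module ℝ V]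

open Module

/-- Spectral theorem for an operator symmetric with respect to a positive definite bilinear form:
there is an orthonormal basis of eigenvectors. -/
lemma exists_orthonormal_eigenbasis [FiniteDimensional ℝ V] (g : V →ₗ[ℝ] V →ₗ[ℝ] ℝ)
    (hsymm : ∀ u v, g u v = g v u) (hpos : ∀ v, v ≠ 0 → 0 < g v v)
    (L : V →ₗ[ℝ] V) (hL : ∀ u v, g (L u) v = g u (L v)) :
    ∃ (n : ℕ) (b : Basis (Fin n) ℝ V) (l : Fin n → ℝ), (∀ i, L (b i) = l i • b i) ∧
      (∀ v, g v v = ∑ i, b.repr v i ^ 2) ∧ LinearMap.det L = ∏ i, l i := by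
  let core : InnerProductSpace.Core ℝ V :=
    { inner := fun u v => g u v
      conj_inner_symm := fun x y => by simpa using hsymm y x
      re_inner_nonneg := fun x => by
        rcases eq_or_ne x 0 with rfl | hx
        · simp
        · simpa using (hpos x hx).le
      add_left := fun x y z => by simp
      smul_left := fun x y r => by simp
      definite := fun x hx => by
        by_contra h
        exact (hpos x h).ne' hx }
  let _ : NormedAddCommGroup V := core.toNormedAddCommGroup
  let _ : InnerProductSpace ℝ V := InnerProductSpace.ofCore core.toCore
  have hsa : L.IsSymmetric := hL
  refine ⟨_, (hsa.eigenvectorBasis rfl).toBasis, hsa.eigenvalues rfl, fun i => ?_, fun v => ?_, ?_⟩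
  · simp
  · have h := (hsa.eigenvectorBasis rfl).sum_sq_norm_inner_right v
    have hv : g v v = ‖v‖ ^ 2 := (real_inner_self_eq_norm_sq v)
    simp only [Real.norm_eq_abs, sq_abs] at h
    simpa [OrthonormalBasis.repr_apply_apply, h] using hv
  · simpa using hsa.det_eq_prod_eigenvalues rfl

/-- An eigenvalue of a positive operator is positive. -/
lemma eigenvalue_pos_of_forall_pos {g : V →ₗ[ℝ] V →ₗ[ℝ] ℝ} (hpos : ∀ v, v ≠ 0 → 0 < g v v)
    {L : V →ₗ[ℝ] V} (hLpos : ∀ v, v ≠ 0 → 0 < g (L v) v) {v : V} (hv : v ≠ 0) {μ : ℝ}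
    (h : L v = μ • v) : 0 < μ := by
  have hv' := hLpos v hv
  rw [h, map_smul, LinearMap.smul_apply, smul_eq_mul] at hv'
  exact pos_of_mul_pos_left hv' (hpos v hv).le

/-- If `f` and a positive symmetric `L` have the same `g`-length function, the operator norm of `f`
is the largest eigenvalue of `L`. -/
lemma opNorm_eq_sSup_hasEigenvalue [FiniteDimensional ℝ V] (g : V →ₗ[ℝ] V →ₗ[ℝ] ℝ)
    (hsymm : ∀ u v, g u v = g v u) (hpos : ∀ v, v ≠ 0 → 0 < g v v)
    (L : V →ₗ[ℝ] V) (hL : ∀ u v, g (L u) v = g u (L v)) (hLpos : ∀ v, v ≠ 0 → 0 < g (L v) v)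
    (f : V →ₗ[ℝ] V) (hf : ∀ v, g (f v) (f v) = g (L v) (L v)) :
    opNorm g f = sSup {μ : ℝ | Module.End.HasEigenvalue L μ} := by
  obtain ⟨n, b, l, hb, hg, -⟩ := exists_orthonormal_eigenbasis g hsymm hpos L hL
  have hl : ∀ i, 0 < l i := fun i =>
    eigenvalue_pos_of_forall_pos hpos hLpos (b.ne_zero i) (hb i)
  have hrepr : ∀ v i, b.repr (L v) i = l i * b.repr v i := fun v i => by
    conv_lhs => rw [← b.sum_repr v]
    simp only [map_sum, map_smul, hb, Finsupp.coe_finsetSum, Finset.sum_apply]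
    simp [Finsupp.single_apply, mul_comm]
  have heig : {μ : ℝ | Module.End.HasEigenvalue L μ} = Set.range l := by
    ext μ
    constructor
    · intro h
      obtain ⟨v, hv⟩ := h.exists_hasEigenvector
      obtain ⟨i, hi⟩ : ∃ i, b.repr v i ≠ 0 := by
        by_contra! h0
        exact hv.2 (b.ext_elem fun i => by simp [h0])
      refine ⟨i, mul_right_cancel₀ hi ?_⟩
      rw [← hrepr, hv.apply_eq_smul, map_smul, Finsupp.smul_apply, smul_eq_mul]
    · rintro ⟨i, rfl⟩
      exact Module.End.hasEigenvalue_of_hasEigenvector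
        ⟨Module.End.mem_eigenspace_iff.2 (hb i), b.ne_zero i⟩
  rw [heig, opNorm]
  rcases isEmpty_or_nonempty (Fin n) with hn | hn
  · have : ∀ v : V, g v v = 0 := fun v => by simp [hg]
    rw [Set.range_eq_empty, Real.sSup_empty]
    refine IsLeast.csInf_eq ⟨⟨le_rfl, fun v => ?_⟩, fun c hc => hc.1⟩
    simp [this]
  · obtain ⟨i, hi⟩ := Finite.exists_max l
    have hsup : IsGreatest (Set.range l) (l i) := ⟨⟨i, rfl⟩, by rintro _ ⟨j, rfl⟩; exact hi j⟩
    rw [hsup.csSup_eq]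
    refine IsLeast.csInf_eq ⟨⟨(hl i).le, fun v => ?_⟩, fun c hc => ?_⟩
    · rw [← Real.sqrt_sq (hl i).le, ← Real.sqrt_mul (sq_nonneg _)]
      refine Real.sqrt_le_sqrt ?_
      rw [hf, hg, hg, Finset.mul_sum]
      refine Finset.sum_le_sum fun j _ => ?_
      rw [hrepr, mul_pow]
      have := (hl j).le
      have := hi j
      gcongr
    · have h := hc.2 (b i)
      have hpos' : 0 < √(g (b i) (b i)) := Real.sqrt_pos.2 (hpos _ (b.ne_zero i))
      have hfi : g (f (b i)) (f (b i)) = l i ^ 2 * g (b i) (b i) := by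
        rw [hf, hb]
        simp only [map_smul, LinearMap.smul_apply, smul_eq_mul]
        ring
      rw [hfi, Real.sqrt_mul (sq_nonneg _), Real.sqrt_sq (hl i).le] at h
      exact le_of_mul_le_mul_right h hpos'

/-- A positive symmetric operator `L` for which `L² s L² = s` satisfies `L s L = s`. -/
lemma comp_comp_eq_of_sq [FiniteDimensional ℝ V] (g : V →ₗ[ℝ] V →ₗ[ℝ] ℝ)
    (hsymm : ∀ u v, g u v = g v u) (hpos : ∀ v, v ≠ 0 → 0 < g v v)
    (L : V →ₗ[ℝ] V) (hL : ∀ u v, g (L u) v = g u (L v)) (hLpos : ∀ v, v ≠ 0 → 0 < g (L v) v)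
    (s : V →ₗ[ℝ] V) (hs : ∀ v, L (L (s (L (L v)))) = s v) (v : V) : L (s (L v)) = s v := by
  obtain ⟨n, b, l, hb, -, -⟩ := exists_orthonormal_eigenbasis g hsymm hpos L hL
  suffices h : L ∘ₗ s ∘ₗ L = s from LinearMap.congr_fun h v
  refine b.ext fun i => ?_
  have hl : 0 < l i := eigenvalue_pos_of_forall_pos hpos hLpos (b.ne_zero i) (hb i)
  have hsq := hs (b i)
  simp only [hb, map_smul, LinearMap.comp_apply] at hsq ⊢
  by_contra hne
  set w := l i • L (s (b i)) - s (b i) with hw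
  have hw0 : w ≠ 0 := sub_ne_zero.2 hne
  have hLw : l i • L w = -w := by
    simp only [hw, map_sub, map_smul, smul_sub, hsq]
    abel
  have h1 := hLpos w hw0
  have h2 : l i * g (L w) w = - g w w := by
    rw [← smul_eq_mul, ← LinearMap.smul_apply, ← map_smul, hLw, map_neg, LinearMap.neg_apply]
  nlinarith [mul_pos hl h1, hpos w hw0]

/-- The determinant of a positive symmetric operator is positive. -/
lemma det_pos_of_forall_pos [FiniteDimensional ℝ V] (g : V →ₗ[ℝ] V →ₗ[ℝ] ℝ)
    (hsymm : ∀ u v, g u v = g v u) (hpos : ∀ v, v ≠ 0 → 0 < g v v)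
    (L : V →ₗ[ℝ] V) (hL : ∀ u v, g (L u) v = g u (L v)) (hLpos : ∀ v, v ≠ 0 → 0 < g (L v) v) :
    0 < LinearMap.det L := by
  obtain ⟨n, b, l, hb, -, hdet⟩ := exists_orthonormal_eigenbasis g hsymm hpos L hL
  rw [hdet]
  exact Finset.prod_pos fun i _ => eigenvalue_pos_of_forall_pos hpos hLpos (b.ne_zero i) (hb i)

namespace SplitMaxNeg

variable {B : V →ₗ[ℝ] V →ₗ[ℝ] ℝ} {W : Submodule ℝ V} {s : V →ₗ[ℝ] V}

lemma exists_add (hW : SplitMaxNeg B W) (v : V) :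
    ∃ w ∈ W, ∃ u ∈ LinearMap.BilinForm.orthogonal B W, w + u = v :=
  Submodule.mem_sup.1 (hW.1.sup_eq_top ▸ Submodule.mem_top)

lemma fundSym_fundSym (hW : SplitMaxNeg B W) (hs : IsFundSym B W s) (v : V) : s (s v) = v := by
  obtain ⟨w, hw, u, hu, rfl⟩ := hW.exists_add v
  simp [hs.1 w hw, hs.2 u hu]

lemma mem_iff_fundSym (hW : SplitMaxNeg B W) (hs : IsFundSym B W s) (v : V) :
    v ∈ W ↔ s v = -v := by
  refine ⟨hs.1 v, fun h => ?_⟩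
  obtain ⟨w, hw, u, hu, rfl⟩ := hW.exists_add v
  have hu0 : u = 0 := by
    rw [map_add, hs.1 w hw, hs.2 u hu, neg_add, add_right_inj] at h
    by_contra hu0
    have h' : B u u = -B u u := by rw [← map_neg, ← h]
    linarith [hW.2.2 u hu hu0]
  simpa [hu0] using hw

lemma gIP_symm (hB : ∀ u v, B u v = B v u) (hW : SplitMaxNeg B W) (hs : IsFundSym B W s)
    (v v' : V) : gIP B s v v' = gIP B s v' v := by
  obtain ⟨w, hw, u, hu, rfl⟩ := hW.exists_add v
  obtain ⟨w', hw', u', hu', rfl⟩ := hW.exists_add v'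
  have h1 : B w u' = 0 := hu' w hw
  have h2 : B w' u = 0 := hu w' hw'
  simp [gIP, hs.1 w hw, hs.2 u hu, hs.1 w' hw', hs.2 u' hu', h1, h2, hB u w', hB u' w, hB w' w,
    hB u' u]

lemma gIP_pos (hB : ∀ u v, B u v = B v u) (hW : SplitMaxNeg B W) (hs : IsFundSym B W s)
    (v : V) (hv : v ≠ 0) : 0 < gIP B s v v := by
  obtain ⟨w, hw, u, hu, rfl⟩ := hW.exists_add v
  have h1 : B w u = 0 := hu w hw
  have hg : gIP B s (w + u) (w + u) = -B w w + B u u := by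
    simp [gIP, hs.1 w hw, hs.2 u hu, h1, hB u w]
  rw [hg]
  rcases eq_or_ne w 0 with rfl | hw0
  · have hu0 : u ≠ 0 := by simpa using hv
    simpa using hW.2.2 u hu hu0
  · have hw' := hW.2.1 w hw hw0
    rcases eq_or_ne u 0 with rfl | hu0
    · simpa using hw'
    · linarith [hW.2.2 u hu hu0]

end SplitMaxNeg

/-- Polar decomposition `Λ = O ∘ L` (with respect to `g_{V₂}`) of an element `Λ ∈ SO(B)`
mapping `V₁` onto `V₂`: then `L, O ∈ SO(B)`, `O(V₂) = V₂`, `L(V₁) = V₂`, and the operator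
norm `‖Λ‖_{g_{V₂}}` equals the largest eigenvalue (spectral radius) of `L`; this common
value is the Doppler shift factor `D.S.F(V₁,V₂)`. -/
theorem statement11 [FiniteDimensional ℝ V]
    (B : V →ₗ[ℝ] V →ₗ[ℝ] ℝ) (hBsymm : ∀ u v : V, B u v = B v u)
    (hBnd : ∀ u : V, (∀ v : V, B u v = 0) → u = 0)
    (V₁ V₂ : Submodule ℝ V) (h₁ : SplitMaxNeg B V₁) (h₂ : SplitMaxNeg B V₂)
    (s₁ s₂ : V →ₗ[ℝ] V) (hs₁ : IsFundSym B V₁ s₁) (hs₂ : IsFundSym B V₂ s₂)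
    (Λ : V ≃ₗ[ℝ] V) (hΛ : MemSO B Λ.toLinearMap)
    (hm : Submodule.map Λ.toLinearMap V₁ = V₂)
    (Λstar : V →ₗ[ℝ] V)
    (hadj : ∀ u v : V, gIP B s₂ (Λstar u) v = gIP B s₂ u (Λ v))
    (L O : V →ₗ[ℝ] V)
    (hpolar : Λ.toLinearMap = O ∘ₗ L)
    (hLsa : ∀ u v : V, gIP B s₂ (L u) v = gIP B s₂ u (L v))
    (hLpos : ∀ v : V, v ≠ 0 → 0 < gIP B s₂ (L v) v)
    (hLsq : L ∘ₗ L = Λstar ∘ₗ Λ.toLinearMap)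
    (hO : ∀ u v : V, gIP B s₂ (O u) (O v) = gIP B s₂ u v) :
    MemSO B L ∧ MemSO B O ∧
      Submodule.map O V₂ = V₂ ∧ Submodule.map L V₁ = V₂ ∧
      opNorm (gIP B s₂) Λ.toLinearMap = sSup {μ : ℝ | Module.End.HasEigenvalue L μ} := by
  set g := gIP B s₂ with hgdef
  have hg : ∀ u v, g u v = B (s₂ u) v := fun _ _ => rfl
  have hgsymm := h₂.gIP_symm hBsymm hs₂
  have hgpos := h₂.gIP_pos hBsymm hs₂
  have hss := h₂.fundSym_fundSym hs₂
  have hΛB : ∀ u v, B (Λ u) (Λ v) = B u v := hΛ.1.2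
  have hΛL : ∀ v, Λ v = O (L v) := LinearMap.congr_fun hpolar
  have hB_eq : ∀ u v, B u v = g (s₂ u) v := fun u v => by rw [hg, hss]
  have hΛs : ∀ u, Λ (s₂ (Λstar u)) = s₂ u := fun u => by
    refine sub_eq_zero.1 (hBnd _ fun v => ?_)
    obtain ⟨v, rfl⟩ := Λ.surjective v
    rw [map_sub, LinearMap.sub_apply, hΛB, ← hg, hadj, hg, sub_self]
  have hΛs' : ∀ u, Λstar (s₂ (Λ u)) = s₂ u := fun u => by
    have h : (s₂ ∘ₗ Λ.toLinearMap) * (s₂ ∘ₗ Λstar) = (1 : Module.End ℝ V) :=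
      LinearMap.ext fun v => by simp [hΛs, hss]
    have h' := LinearMap.congr_fun (mul_eq_one_comm.1 h) u
    simp only [Module.End.mul_apply, LinearMap.comp_apply, Module.End.one_apply,
      LinearEquiv.coe_coe] at h'
    rw [← hss (Λstar _), h']
  have hLL : ∀ v, L (L v) = Λstar (Λ v) := LinearMap.congr_fun hLsq
  have hLsL := comp_comp_eq_of_sq g hgsymm hgpos L hLsa hLpos s₂ fun v => by
    rw [hLL, hLL, hΛs, hΛs']
  have hLB : ∀ u v, B (L u) (L v) = B u v := fun u v => by
    rw [hB_eq, ← hLsa, hLsL, ← hB_eq]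
  have hLinj : Function.Injective L := (injective_iff_map_eq_zero L).2 fun v hv => by
    by_contra hv0
    simpa [hv] using hLpos v hv0
  have hLsurj : Function.Surjective L := LinearMap.injective_iff_surjective.1 hLinj
  have hOB : ∀ u v, B (O u) (O v) = B u v := fun u v => by
    obtain ⟨u, rfl⟩ := hLsurj u
    obtain ⟨v, rfl⟩ := hLsurj v
    rw [← hΛL, ← hΛL, hΛB, hLB]
  have hOsurj : Function.Surjective O := fun v => by
    obtain ⟨u, rfl⟩ := Λ.surjective v
    exact ⟨L u, (hΛL u).symm⟩
  have hOinj : Function.Injective O := LinearMap.injective_iff_surjective.2 hOsurj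
  have hLdet : LinearMap.det L = 1 := by
    have hs : LinearMap.det s₂ * LinearMap.det s₂ = 1 := by
      rw [← LinearMap.det_comp, show s₂ ∘ₗ s₂ = LinearMap.id from LinearMap.ext hss,
        LinearMap.det_id]
    have h : LinearMap.det L * (LinearMap.det s₂ * LinearMap.det L) = LinearMap.det s₂ := by
      rw [← LinearMap.det_comp, ← LinearMap.det_comp]
      exact congrArg _ (LinearMap.ext hLsL)
    have hsq : LinearMap.det L ^ 2 = 1 := by
      linear_combination LinearMap.det s₂ * h + (1 - LinearMap.det L ^ 2) * hs
    have h' := det_pos_of_forall_pos g hgsymm hgpos L hLsa hLpos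
    nlinarith
  have hOdet : LinearMap.det O = 1 := by
    have h := hΛ.2
    rwa [hpolar, LinearMap.det_comp, hLdet, mul_one] at h
  have hOs : ∀ v, s₂ (O v) = O (s₂ v) := fun v => by
    refine sub_eq_zero.1 (hBnd _ fun w => ?_)
    obtain ⟨w, rfl⟩ := hOsurj w
    rw [map_sub, LinearMap.sub_apply, hOB, ← hg, hO, hg, sub_self]
  have hOmem : ∀ v, O v ∈ V₂ ↔ v ∈ V₂ := fun v => by
    rw [h₂.mem_iff_fundSym hs₂, h₂.mem_iff_fundSym hs₂, hOs, ← map_neg, hOinj.eq_iff]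
  have hOV : Submodule.map O V₂ = V₂ := by
    ext v
    obtain ⟨v, rfl⟩ := hOsurj v
    rw [hOmem, Submodule.mem_map]
    exact ⟨fun ⟨w, hw, h⟩ => hOinj h ▸ hw, fun h => ⟨v, h, rfl⟩⟩
  refine ⟨⟨⟨⟨hLinj, hLsurj⟩, hLB⟩, hLdet⟩, ⟨⟨⟨hOinj, hOsurj⟩, hOB⟩, hOdet⟩, hOV, ?_, ?_⟩
  · refine Submodule.map_injective_of_injective hOinj ?_
    rw [← Submodule.map_comp, ← hpolar, hm, hOV]
  · refine opNorm_eq_sSup_hasEigenvalue g hgsymm hgpos L hLsa hLpos _ fun v => ?_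
    rw [LinearEquiv.coe_coe, hΛL, hO]
end

section
/- Let V₁ and V₂ be split maximal negative definite subspaces of (V,B) and let Λ ∈ SO(B) satisfy Λ(V₁) = V₂. Then ‖Λ‖_{g_{V₂}} = ‖Λ⁻¹‖_{g_{V₁}}. Consequently the Doppler shift factor is symmetric: D.S.F(V₁,V₂) = D.S.F(V₂,V₁). -/
variable {V : Type*} [AddCommGroup V] [Module ℝ V]

section FundamentalSymmetry

variable {B : V →ₗ[ℝ] V →ₗ[ℝ] ℝ} {W W₁ W₂ : Submodule ℝ V} {s s₁ s₂ f : V →ₗ[ℝ] V}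

theorem SplitMaxNeg.exists_add_s12 (h : SplitMaxNeg B W) (v : V) :
    ∃ w ∈ W, ∃ u ∈ LinearMap.BilinForm.orthogonal B W, v = w + u := by
  have hv : v ∈ W ⊔ LinearMap.BilinForm.orthogonal B W := by
    rw [h.1.sup_eq_top]; trivial
  obtain ⟨w, hw, u, hu, rfl⟩ := Submodule.mem_sup.1 hv
  exact ⟨w, hw, u, hu, rfl⟩

theorem IsFundSym.involutive (h : SplitMaxNeg B W) (hs : IsFundSym B W s) (v : V) :
    s (s v) = v := by
  obtain ⟨w, hw, u, hu, rfl⟩ := h.exists_add_s12 v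
  simp [hs.1 w hw, hs.2 u hu]

theorem IsFundSym.apply_left_eq (hB : ∀ u v : V, B u v = B v u) (h : SplitMaxNeg B W)
    (hs : IsFundSym B W s) (x y : V) : B (s x) y = B x (s y) := by
  obtain ⟨w, hw, u, hu, rfl⟩ := h.exists_add_s12 x
  obtain ⟨w', hw', u', hu', rfl⟩ := h.exists_add_s12 y
  have h1 : B w u' = 0 := hu' w hw
  have h2 : B u w' = 0 := (hB u w').trans (hu w' hw')
  simp [hs.1 w hw, hs.2 u hu, hs.1 w' hw', hs.2 u' hu', h1, h2]

theorem IsFundSym.gIP_pos (hB : ∀ u v : V, B u v = B v u) (h : SplitMaxNeg B W)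
    (hs : IsFundSym B W s) {v : V} (hv : v ≠ 0) : 0 < gIP B s v v := by
  obtain ⟨w, hw, u, hu, rfl⟩ := h.exists_add_s12 v
  have h1 : B w u = 0 := hu w hw
  have h2 : B u w = 0 := (hB u w).trans h1
  have key : gIP B s (w + u) (w + u) = -B w w + B u u := by
    simp [gIP, hs.1 w hw, hs.2 u hu, h1, h2]
  rw [key]
  by_cases hw0 : w = 0
  · have hu0 : u ≠ 0 := by rintro rfl; simp [hw0] at hv
    simpa [hw0] using h.2.2 u hu hu0
  · have := h.2.1 w hw hw0
    by_cases hu0 : u = 0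
    · simpa [hu0] using this
    · linarith [h.2.2 u hu hu0]

theorem IsFundSym.gIP_nonneg (hB : ∀ u v : V, B u v = B v u) (h : SplitMaxNeg B W)
    (hs : IsFundSym B W s) (v : V) : 0 ≤ gIP B s v v := by
  rcases eq_or_ne v 0 with rfl | hv
  · simp
  · exact (hs.gIP_pos hB h hv).le

theorem MemO.apply_mem_orthogonal (hf : MemO B f) (hm : W₁.map f = W₂) {u : V}
    (hu : u ∈ LinearMap.BilinForm.orthogonal B W₁) :
    f u ∈ LinearMap.BilinForm.orthogonal B W₂ := by
  subst hm
  rintro _ ⟨w, hw, rfl⟩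
  exact (hf.2 w u).trans (hu w hw)

/-- An isometry carrying `W₁` onto `W₂` carries `g_{W₁}` to `g_{W₂}`. -/
theorem MemO.gIP_apply (hf : MemO B f) (h₁ : SplitMaxNeg B W₁) (hs₁ : IsFundSym B W₁ s₁)
    (hs₂ : IsFundSym B W₂ s₂) (hm : W₁.map f = W₂) (x y : V) :
    gIP B s₂ (f x) (f y) = gIP B s₁ x y := by
  have key : s₂ (f x) = f (s₁ x) := by
    obtain ⟨w, hw, u, hu, rfl⟩ := h₁.exists_add_s12 x
    have hfw : f w ∈ W₂ := hm ▸ Submodule.mem_map_of_mem hw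
    simp [hs₁.1 w hw, hs₁.2 u hu, hs₂.1 _ hfw, hs₂.2 _ (hf.apply_mem_orthogonal hm hu)]
  simp [gIP, key, hf.2]

theorem IsFundSym.gIP_le_symm (hB : ∀ u v : V, B u v = B v u) (h₁ : SplitMaxNeg B W₁)
    (h₂ : SplitMaxNeg B W₂) (hs₁ : IsFundSym B W₁ s₁) (hs₂ : IsFundSym B W₂ s₂) {K : ℝ}
    (hK : ∀ v, gIP B s₁ v v ≤ K * gIP B s₂ v v) (v : V) :
    gIP B s₂ v v ≤ K * gIP B s₁ v v := by
  rcases eq_or_ne v 0 with rfl | hv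
  · simp
  have hsymm : ∀ x y, gIP B s₁ x y = gIP B s₁ y x := fun x y => by
    simp only [gIP, LinearMap.comp_apply]
    rw [hs₁.apply_left_eq hB h₁, hB]
  have hcs := LinearMap.BilinForm.apply_sq_le_of_symm (gIP B s₁) (hs₁.gIP_nonneg hB h₁)
    ⟨hsymm⟩ (s₁ (s₂ v)) v
  have hmixed : gIP B s₁ (s₁ (s₂ v)) v = gIP B s₂ v v := by
    simp [gIP, hs₁.involutive h₁]
  have hw : gIP B s₁ (s₁ (s₂ v)) (s₁ (s₂ v)) = gIP B s₁ (s₂ v) (s₂ v) := by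
    simp only [gIP, LinearMap.comp_apply]
    rw [hs₁.involutive h₁, hB]
  have hs₂v : gIP B s₂ (s₂ v) (s₂ v) = gIP B s₂ v v := by
    simp only [gIP, LinearMap.comp_apply]
    rw [hs₂.involutive h₂, hB]
  have hle := hK (s₂ v)
  rw [hs₂v] at hle
  rw [hmixed, hw] at hcs
  have hmul := mul_le_mul_of_nonneg_right hle (hs₁.gIP_nonneg hB h₁ v)
  refine le_of_mul_le_mul_left ?_ (hs₂.gIP_pos hB h₂ hv)
  linarith

theorem sqrt_le_mul_sqrt_iff {a b c : ℝ} (hb : 0 ≤ b) (hc : 0 ≤ c) :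
    √a ≤ c * √b ↔ a ≤ c ^ 2 * b := by
  rw [Real.sqrt_le_left (by positivity), mul_pow, Real.sq_sqrt hb]

theorem opNorm_gIP_eq (hB : ∀ u v : V, B u v = B v u) (h₁ : SplitMaxNeg B W₁)
    (h₂ : SplitMaxNeg B W₂) (hs₁ : IsFundSym B W₁ s₁) (hs₂ : IsFundSym B W₂ s₂)
    {f' : V →ₗ[ℝ] V} (hf : MemO B f) (hm : W₁.map f = W₂) (hf' : MemO B f')
    (hm' : W₂.map f' = W₁) : opNorm (gIP B s₂) f = opNorm (gIP B s₁) f' := by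
  unfold opNorm
  congr 1
  ext c
  refine and_congr_right fun hc => ?_
  simp only [hf.gIP_apply h₁ hs₁ hs₂ hm, hf'.gIP_apply h₂ hs₂ hs₁ hm',
    sqrt_le_mul_sqrt_iff (hs₁.gIP_nonneg hB h₁ _) hc,
    sqrt_le_mul_sqrt_iff (hs₂.gIP_nonneg hB h₂ _) hc]
  exact ⟨hs₁.gIP_le_symm hB h₁ h₂ hs₂, hs₂.gIP_le_symm hB h₂ h₁ hs₁⟩

end FundamentalSymmetry

/-- If `Λ ∈ SO(B)` maps the split maximal negative definite subspace `V₁` onto `V₂` then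
`‖Λ‖_{g_{V₂}} = ‖Λ⁻¹‖_{g_{V₁}}`; consequently the Doppler shift factor is symmetric:
`‖Λ‖_{g_{V₂}} = ‖Λ'‖_{g_{V₁}}` for any `Λ' ∈ SO(B)` with `Λ'(V₂) = V₁`, i.e.
`D.S.F(V₁,V₂) = D.S.F(V₂,V₁)`. -/
theorem statement12 [FiniteDimensional ℝ V]
    (B : V →ₗ[ℝ] V →ₗ[ℝ] ℝ) (hBsymm : ∀ u v : V, B u v = B v u)
    (hBnd : ∀ u : V, (∀ v : V, B u v = 0) → u = 0)
    (V₁ V₂ : Submodule ℝ V) (h₁ : SplitMaxNeg B V₁) (h₂ : SplitMaxNeg B V₂)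
    (s₁ s₂ : V →ₗ[ℝ] V) (hs₁ : IsFundSym B V₁ s₁) (hs₂ : IsFundSym B V₂ s₂)
    (Λ : V ≃ₗ[ℝ] V) (hΛ : MemSO B Λ.toLinearMap)
    (hm : Submodule.map Λ.toLinearMap V₁ = V₂) :
    opNorm (gIP B s₂) Λ.toLinearMap = opNorm (gIP B s₁) Λ.symm.toLinearMap ∧
      ∀ Λ' : V ≃ₗ[ℝ] V, MemSO B Λ'.toLinearMap → Submodule.map Λ'.toLinearMap V₂ = V₁ →
        opNorm (gIP B s₂) Λ.toLinearMap = opNorm (gIP B s₁) Λ'.toLinearMap := by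
  have hsymm : MemO B Λ.symm.toLinearMap :=
    ⟨Λ.symm.bijective, fun u v => by simpa using (hΛ.1.2 (Λ.symm u) (Λ.symm v)).symm⟩
  have hmsymm : Submodule.map Λ.symm.toLinearMap V₂ = V₁ := by
    rw [← hm, ← Submodule.map_comp]
    simp
  exact ⟨opNorm_gIP_eq hBsymm h₁ h₂ hs₁ hs₂ hΛ.1 hm hsymm hmsymm,
    fun Λ' hΛ' hm' => opNorm_gIP_eq hBsymm h₁ h₂ hs₁ hs₂ hΛ.1 hm hΛ'.1 hm'⟩
end
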